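/- Let (R, m) be a commutative Noetherian local ring, M and N nonzero finitely generated R-modules with N Tor-rigid. Let n = grade(M) = inf{i : Ext^i_R(M,R) ≠ 0} and s = grade(M,N) = inf{i : Ext^i_R(M,N) ≠ 0}. Then s ≤ n and Ext^i_R(M,N) ≠ 0 for all i with s ≤ i ≤ n. -/

import Mathlib

open CategoryTheory

noncomputable section

variable (R : Type) [CommRing R]

/-- `Ext^n_R(M,N)` as an `R`-module object. -/
abbrev ext (n : ℕ) (M N : ModuleCat R) : ModuleCat R :=
  ((Ext R (ModuleCat R) n).obj (Opposite.op M)).obj N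

/-- `Tor_n^R(M,N)`. -/
abbrev tor (n : ℕ) (M N : ModuleCat R) : ModuleCat R :=
  ((Tor (ModuleCat R) n).obj M).obj N

/-- projective dimension, via vanishing of `Ext` in degrees above `n`. -/
def projDim (M : ModuleCat R) : ℕ∞ :=
  sInf {n : ℕ∞ | ∀ (i : ℕ) (X : ModuleCat R), n < i → Subsingleton (ext R i M X)}

/-- injective dimension, via vanishing of `Ext` in degrees above `n`. -/
def injDim (N : ModuleCat R) : ℕ∞ :=
  sInf {n : ℕ∞ | ∀ (i : ℕ) (X : ModuleCat R), n < i → Subsingleton (ext R i X N)}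

/-- depth over a local ring, as the least `n` with `Ext^n(k, N) ≠ 0`. -/
def depth [IsLocalRing R] (N : ModuleCat R) : ℕ∞ :=
  sInf {n : ℕ∞ | ∃ i : ℕ, n = i ∧
    ¬ Subsingleton (ext R i (ModuleCat.of R (IsLocalRing.ResidueField R)) N)}

/-- Tor-rigidity. -/
def TorRigid (N : ModuleCat R) : Prop :=
  ∀ (X : ModuleCat R), Module.Finite R X → ∀ n : ℕ, 1 ≤ n →
    Subsingleton (tor R n N X) → Subsingleton (tor R (n + 1) N X)

/-- test module for projectivity. -/
def TestModule (M : ModuleCat R) : Prop :=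
  ∀ (X : ModuleCat R), Module.Finite R X → projDim R X = ⊤ →
    {j : ℕ | ¬ Subsingleton (tor R j M X)}.Infinite

/-- strongly-rigid module. -/
def StronglyRigid (N : ModuleCat R) : Prop :=
  ∀ (X : ModuleCat R), Module.Finite R X → ∀ n : ℕ, 1 ≤ n →
    Subsingleton (tor R n N X) → projDim R X < ⊤

/-- rigid-test module. -/
def RigidTest (N : ModuleCat R) : Prop :=
  ∀ (X : ModuleCat R), Module.Finite R X → ∀ n : ℕ, 1 ≤ n →
    Subsingleton (tor R n N X) →
      Subsingleton (tor R (n + 1) N X) ∧ projDim R X < ⊤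




open CategoryTheory Limits

variable {R}

theorem sub_iff_isZero (A : ModuleCat R) : Subsingleton A ↔ IsZero A :=
  ⟨fun _ => ModuleCat.isZero_of_subsingleton A, fun h => ModuleCat.subsingleton_of_isZero h⟩

/-- chain complex from an exact sequence -/
def mkCx (X : ℕ → ModuleCat R) (d : ∀ n, X (n + 1) ⟶ X n)
    (hd : ∀ n, Function.Exact (d (n + 1)).hom (d n).hom) : ChainComplex (ModuleCat R) ℕ :=
  ChainComplex.of X d (fun n => by ext x; exact (hd n).apply_apply_eq_zero x)

theorem mkCx_d (X : ℕ → ModuleCat R) (d : ∀ n, X (n + 1) ⟶ X n)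
    (hd : ∀ n, Function.Exact (d (n + 1)).hom (d n).hom) (n : ℕ) :
    (mkCx X d hd).d (n + 1) n = d n :=
  ChainComplex.of_d X d n

/-- resolution from a sequence -/
def mkRes {Z : ModuleCat R} (X : ℕ → ModuleCat R) (d : ∀ n, X (n + 1) ⟶ X n) (ε : X 0 ⟶ Z)
    (hp : ∀ n, Projective (X n)) (hd : ∀ n, Function.Exact (d (n + 1)).hom (d n).hom)
    (h0 : Function.Exact (d 0).hom ε.hom) (hε : Function.Surjective ε.hom) :
    ProjectiveResolution Z where
  complex := mkCx X d hd
  projective := hp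
  π := (ChainComplex.toSingle₀Equiv (mkCx X d hd) Z).symm ⟨ε, by
    rw [mkCx_d]
    ext x; exact h0.apply_apply_eq_zero x⟩
  quasiIso := ⟨fun n => by
    cases n
    · rw [ChainComplex.quasiIsoAt₀_iff, ShortComplex.quasiIso_iff_of_zeros' _ rfl rfl rfl]
      have w : d 0 ≫ ε = 0 := by ext x; exact h0.apply_apply_eq_zero x
      refine (ShortComplex.exact_and_epi_g_iff_of_iso (S₂ := ShortComplex.mk (d 0) ε w) ?_).2 ⟨?_, ?_⟩
      · refine ShortComplex.isoMk (Iso.refl _) (Iso.refl _) (Iso.refl _) ?_ ?_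
        · refine (Category.id_comp _).trans (Eq.trans ?_ (Category.comp_id _).symm)
          exact (mkCx_d X d hd 0).symm
        · refine (Category.id_comp _).trans (Eq.trans ?_ (Category.comp_id _).symm)
          exact (ChainComplex.toSingle₀Equiv_symm_apply_f_zero (C := mkCx X d hd) ε _).symm
      · rw [ShortComplex.moduleCat_exact_iff]; exact fun x hx => (h0 x).1 hx
      · exact (ModuleCat.epi_iff_surjective _).2 hε
    · rename_i n
      rw [quasiIsoAt_iff_exactAt']
      · rw [HomologicalComplex.exactAt_iff' _ (n + 1 + 1) (n + 1) n (by simp) (by simp)]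
        rw [ShortComplex.moduleCat_exact_iff]
        change ∀ x, (mkCx X d hd).d (n+1) n x = 0 → ∃ y, (mkCx X d hd).d (n+1+1) (n+1) y = x
        rw [mkCx_d, mkCx_d]
        exact fun x hx => (hd n x).1 hx
      · apply ChainComplex.exactAt_succ_single_obj⟩


open MonoidalCategory in
theorem tor_crit {Z : ModuleCat R} (X : ℕ → ModuleCat R) (d : ∀ n, X (n + 1) ⟶ X n) (ε : X 0 ⟶ Z)
    (hp : ∀ n, Projective (X n)) (hd : ∀ n, Function.Exact (d (n + 1)).hom (d n).hom)
    (h0 : Function.Exact (d 0).hom ε.hom) (hε : Function.Surjective ε.hom)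
    (N : ModuleCat R) (k : ℕ) : Subsingleton (tor R (k + 1) N Z) ↔
    Function.Exact ((d (k + 1)).hom.lTensor N) ((d k).hom.lTensor N) := by
  rw [sub_iff_isZero]
  refine (((mkRes X d ε hp hd h0 hε).isoLeftDerivedObj
    ((MonoidalCategory.tensoringLeft (ModuleCat R)).obj N) (k+1)).isZero_iff).trans ?_
  rw [HomologicalComplex.homologyFunctor_obj, ← HomologicalComplex.exactAt_iff_isZero_homology]
  rw [HomologicalComplex.exactAt_iff' _ (k + 1 + 1) (k + 1) k (by simp) (by simp)]
  rw [ShortComplex.moduleCat_exact_iff]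
  change (∀ x, (N ◁ (mkCx X d hd).d (k+1) k).hom x = 0 →
     ∃ y, (N ◁ (mkCx X d hd).d (k+1+1) (k+1)).hom y = x) ↔ _
  rw [mkCx_d, mkCx_d]
  refine ⟨fun h x => ⟨h x, ?_⟩, fun h x hx => (h x).1 hx⟩
  rintro ⟨y, rfl⟩
  have := (hd k).linearMap_comp_eq_zero
  rw [← LinearMap.comp_apply, ← LinearMap.lTensor_comp, this]
  simp

theorem ext_crit {Z : ModuleCat R} (X : ℕ → ModuleCat R) (d : ∀ n, X (n + 1) ⟶ X n) (ε : X 0 ⟶ Z)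
    (hp : ∀ n, Projective (X n)) (hd : ∀ n, Function.Exact (d (n + 1)).hom (d n).hom)
    (h0 : Function.Exact (d 0).hom ε.hom) (hε : Function.Surjective ε.hom)
    (N : ModuleCat R) (k : ℕ) : Subsingleton (ext R (k + 1) Z N) ↔
    Function.Exact (LinearMap.lcomp R N (d k).hom) (LinearMap.lcomp R N (d (k+1)).hom) := by
  rw [sub_iff_isZero, ((mkRes X d ε hp hd h0 hε).isoExt (R := R) (k+1) N).isZero_iff]
  rw [← HomologicalComplex.exactAt_iff_isZero_homology]
  rw [HomologicalComplex.exactAt_iff' _ k (k + 1) (k + 1 + 1) (by simp) (by simp)]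
  rw [ShortComplex.moduleCat_exact_iff]
  change (∀ x : X (k+1) ⟶ N, (mkCx X d hd).d (k+1+1) (k+1) ≫ x = 0 →
     ∃ y : X k ⟶ N, (mkCx X d hd).d (k+1) k ≫ y = x) ↔ _
  rw [mkCx_d, mkCx_d]
  constructor
  · refine fun h x => ⟨fun hx => ?_, ?_⟩
    · obtain ⟨y, hy⟩ := h (ModuleCat.ofHom x) (ModuleCat.hom_ext hx)
      exact ⟨y.hom, by rw [← ModuleCat.hom_ofHom x, ← hy]; rfl⟩
    · rintro ⟨y, rfl⟩
      ext z
      simp [(hd k).apply_apply_eq_zero]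
  · intro h x hx
    obtain ⟨y, hy⟩ := (h x.hom).1 (congrArg ModuleCat.Hom.hom hx)
    exact ⟨ModuleCat.ofHom y, ModuleCat.hom_ext hy⟩

theorem ext_crit0 {Z : ModuleCat R} (X : ℕ → ModuleCat R) (d : ∀ n, X (n + 1) ⟶ X n) (ε : X 0 ⟶ Z)
    (hp : ∀ n, Projective (X n)) (hd : ∀ n, Function.Exact (d (n + 1)).hom (d n).hom)
    (h0 : Function.Exact (d 0).hom ε.hom) (hε : Function.Surjective ε.hom)
    (N : ModuleCat R) : Subsingleton (ext R 0 Z N) ↔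
    Function.Injective (LinearMap.lcomp R N (d 0).hom) := by
  rw [sub_iff_isZero, ((mkRes X d ε hp hd h0 hε).isoExt (R := R) 0 N).isZero_iff]
  rw [← HomologicalComplex.exactAt_iff_isZero_homology]
  rw [HomologicalComplex.exactAt_iff' _ 0 0 1 (by simp) (by simp)]
  rw [ShortComplex.moduleCat_exact_iff]
  change (∀ x : X 0 ⟶ N, (mkCx X d hd).d (0+1) 0 ≫ x = 0 →
     ∃ y : X 0 ⟶ N, (mkCx X d hd).d 0 0 ≫ y = x) ↔ _
  rw [mkCx_d, (mkCx X d hd).shape 0 0 (by simp), injective_iff_map_eq_zero]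
  constructor
  · intro h x hx
    obtain ⟨y, hy⟩ := h (ModuleCat.ofHom x) (ModuleCat.hom_ext hx)
    exact (congrArg ModuleCat.Hom.hom ((zero_comp (X := X 0) (f := y)).symm.trans hy)).symm
  · intro h x hx
    have h1 : x = 0 := ModuleCat.hom_ext (h x.hom (congrArg ModuleCat.Hom.hom hx))
    exact ⟨0, (zero_comp (X := X 0)).trans h1.symm⟩


/-! ### Nakayama -/
open TensorProduct

theorem exists_surj_residue [IsLocalRing R] (N : Type) [AddCommGroup N] [Module R N]
    [Module.Finite R N] [Nontrivial N] :
    ∃ φ : N →ₗ[R] IsLocalRing.ResidueField R, Function.Surjective φ := by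
  let k := IsLocalRing.ResidueField R
  have h1 : Nontrivial (k ⊗[R] N) := by
    rw [← not_subsingleton_iff_nontrivial, IsLocalRing.subsingleton_tensorProduct,
      not_subsingleton_iff_nontrivial]
    infer_instance
  obtain ⟨v, hv⟩ := exists_ne (0 : k ⊗[R] N)
  obtain ⟨φ, hφ⟩ : ∃ φ : Module.Dual k (k ⊗[R] N), φ v ≠ 0 := by
    by_contra! h
    exact hv ((Module.forall_dual_apply_eq_zero_iff k v).1 h)
  have hs : Function.Surjective φ := LinearMap.surjective (fun h => hφ (by rw [h]; rfl))
  refine ⟨(φ.restrictScalars R) ∘ₗ (TensorProduct.mk R k N 1), ?_⟩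
  exact hs.comp (TensorProduct.mk_surjective R N k IsLocalRing.residue_surjective)

theorem subsingleton_of_tensor [IsLocalRing R] (N Q : Type) [AddCommGroup N] [Module R N]
    [Module.Finite R N] [Nontrivial N] [AddCommGroup Q] [Module R Q] [Module.Finite R Q]
    (h : Subsingleton (N ⊗[R] Q)) : Subsingleton Q := by
  obtain ⟨φ, hφ⟩ := exists_surj_residue (R := R) N
  rw [← IsLocalRing.subsingleton_tensorProduct (R := R)]
  exact (LinearMap.rTensor_surjective Q hφ).subsingleton

theorem surj_of_lTensor_surj [IsLocalRing R] (N : Type) {A K : Type} [AddCommGroup N] [Module R N]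
    [Module.Finite R N] [Nontrivial N] [AddCommGroup A] [Module R A]
    [AddCommGroup K] [Module R K] [Module.Finite R K] (f : A →ₗ[R] K)
    (h : Function.Surjective (f.lTensor N)) : Function.Surjective f := by
  rw [← LinearMap.range_eq_top, ← Submodule.Quotient.subsingleton_iff]
  apply subsingleton_of_tensor (R := R) N
  refine ⟨fun a b => ?_⟩
  have key : ∀ a : N ⊗[R] (K ⧸ LinearMap.range f), a = 0 := by
    intro a
    obtain ⟨b, rfl⟩ := LinearMap.lTensor_surjective N (Submodule.mkQ_surjective (LinearMap.range f)) a
    obtain ⟨c, rfl⟩ := h b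
    rw [← LinearMap.comp_apply, ← LinearMap.lTensor_comp, LinearMap.range_mkQ_comp]
    simp
  rw [key a, key b]

/-! ### Free sequences -/

theorem exists_cover [IsNoetherianRing R] {A B : ModuleCat.{0} R} (f : A ⟶ B) :
    ∃ (C : ModuleCat.{0} R) (g : C ⟶ A), Function.Exact g.hom f.hom ∧ Module.Free R C ∧
      (Module.Finite R A → Module.Finite R C) := by
  by_cases hA : Module.Finite R A
  · obtain ⟨n, p, hp⟩ := Module.Finite.exists_fin' R (LinearMap.ker f.hom)
    refine ⟨ModuleCat.of R (Fin n → R), ModuleCat.ofHom ((LinearMap.ker f.hom).subtype ∘ₗ p),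
      ?_, inferInstanceAs (Module.Free R (Fin n → R)),
      fun _ => inferInstanceAs (Module.Finite R (Fin n → R))⟩
    rw [LinearMap.exact_iff, ModuleCat.hom_ofHom, LinearMap.range_comp, LinearMap.range_eq_top.2 hp]
    simp
  · refine ⟨ModuleCat.of R (LinearMap.ker f.hom →₀ R),
      ModuleCat.ofHom ((LinearMap.ker f.hom).subtype ∘ₗ Finsupp.linearCombination R id),
      ?_, inferInstanceAs (Module.Free R (_ →₀ R)), fun h => (hA h).elim⟩
    rw [LinearMap.exact_iff, ModuleCat.hom_ofHom, LinearMap.range_comp,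
      LinearMap.range_eq_top.2 (Finsupp.linearCombination_id_surjective R _)]
    simp

/-- an arrow of modules -/
structure Arr (R : Type) [CommRing R] where
  /-- source -/
  A : ModuleCat.{0} R
  /-- target -/
  B : ModuleCat.{0} R
  /-- map -/
  f : A ⟶ B

/-- next arrow in a free resolution -/
def Arr.next [IsNoetherianRing R] (s : Arr R) : Arr R :=
  ⟨(exists_cover s.f).choose, s.A, (exists_cover s.f).choose_spec.choose⟩

/-- iterated covers -/
def Arr.seq [IsNoetherianRing R] (s : Arr R) (n : ℕ) : Arr R :=
  Nat.rec s (fun _ t => t.next) n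

/-- terms of the resolution -/
def Arr.X [IsNoetherianRing R] (s : Arr R) (n : ℕ) : ModuleCat R := (s.seq n).B

/-- differentials of the resolution -/
def Arr.d [IsNoetherianRing R] (s : Arr R) (n : ℕ) : s.X (n + 1) ⟶ s.X n := (s.seq n).f

theorem Arr.exact [IsNoetherianRing R] (s : Arr R) (n : ℕ) :
    Function.Exact (s.d (n + 1)).hom (s.d n).hom :=
  (exists_cover (s.seq n).f).choose_spec.choose_spec.1

theorem Arr.free [IsNoetherianRing R] (s : Arr R) (hA : Module.Free R s.A)
    (hB : Module.Free R s.B) : ∀ n, Module.Free R (s.X n)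
  | 0 => hB
  | 1 => hA
  | n + 2 => (exists_cover (s.seq n).f).choose_spec.choose_spec.2.1

theorem Arr.finite [IsNoetherianRing R] (s : Arr R) (hA : Module.Finite R s.A)
    (hB : Module.Finite R s.B) : ∀ n, Module.Finite R (s.X n)
  | 0 => hB
  | 1 => hA
  | n + 2 => (exists_cover (s.seq n).f).choose_spec.choose_spec.2.2 (Arr.finite s hA hB (n + 1))

theorem Arr.proj [IsNoetherianRing R] (s : Arr R) (hA : Module.Free R s.A)
    (hB : Module.Free R s.B) (n : ℕ) : Projective (s.X n) := by
  have := s.free hA hB n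
  exact (IsProjective.iff_projective (R := R) (s.X n)).1 Module.Projective.of_free

/-! ### key lemma -/

theorem key_lemma [IsNoetherianRing R] [IsLocalRing R] (N : ModuleCat R) [Module.Finite R N]
    [Nontrivial N] (hrig : TorRigid R N) {A B C : Type} [AddCommGroup A] [Module R A]
    [AddCommGroup B] [Module R B] [AddCommGroup C] [Module R C] [Module.Free R B]
    [Module.Finite R B] [Module.Free R C] [Module.Finite R C]
    (g0 : A →ₗ[R] B) (g1 : B →ₗ[R] C) (h01 : g1 ∘ₗ g0 = 0)
    (hN : Function.Exact (g0.lTensor N) (g1.lTensor N)) :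
    Function.Injective ((LinearMap.ker g1).subtype.lTensor N) ∧ Function.Exact g0 g1 := by
  let s : Arr R := ⟨ModuleCat.of R B, ModuleCat.of R C, ModuleCat.ofHom g1⟩
  have fA : Module.Free R s.A := ‹Module.Free R B›
  have fB : Module.Free R s.B := ‹Module.Free R C›
  let Z : ModuleCat R := ModuleCat.of R (C ⧸ LinearMap.range g1)
  have hZ : Module.Finite R Z := inferInstanceAs (Module.Finite R (C ⧸ LinearMap.range g1))
  let ε : s.X 0 ⟶ Z := ModuleCat.ofHom (LinearMap.range g1).mkQ
  have crit := tor_crit s.X s.d ε (s.proj fA fB) s.exact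
    (LinearMap.exact_map_mkQ_range g1) (Submodule.mkQ_surjective _) N
  let q : s.X 2 →ₗ[R] B := (s.d 1).hom
  have hq : Function.Exact q g1 := s.exact 0
  let K := LinearMap.ker g1
  let q' : s.X 2 →ₗ[R] K := q.codRestrict K (fun x => hq.apply_apply_eq_zero x)
  have hq's : Function.Surjective q' := by
    rintro ⟨x, hx⟩
    obtain ⟨y, hy⟩ := (hq x).1 hx
    exact ⟨y, Subtype.ext hy⟩
  have hqq : q = K.subtype ∘ₗ q' := rfl
  let g' : A →ₗ[R] K := g0.codRestrict K (fun x => LinearMap.congr_fun h01 x)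
  have hgg : g0 = K.subtype ∘ₗ g' := rfl
  have hq'N := LinearMap.lTensor_surjective N hq's
  have t1 : Subsingleton (tor R 1 N Z) := by
    refine (crit 0).2 ?_
    change Function.Exact (q.lTensor N) (g1.lTensor N)
    intro x
    constructor
    · intro hx
      obtain ⟨y, rfl⟩ := (hN x).1 hx
      obtain ⟨z, hz⟩ := hq'N (g'.lTensor N y)
      refine ⟨z, ?_⟩
      rw [hqq, hgg, LinearMap.lTensor_comp, LinearMap.lTensor_comp, LinearMap.comp_apply,
        LinearMap.comp_apply, hz]
    · rintro ⟨y, rfl⟩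
      rw [← LinearMap.comp_apply, ← LinearMap.lTensor_comp, hq.linearMap_comp_eq_zero]
      simp
  have t2 := (crit 1).1 (hrig Z hZ 1 le_rfl t1)
  have inj : Function.Injective (K.subtype.lTensor N) := by
    rw [injective_iff_map_eq_zero]
    intro z hz
    obtain ⟨w, rfl⟩ := hq'N z
    rw [← LinearMap.comp_apply, ← LinearMap.lTensor_comp, ← hqq] at hz
    obtain ⟨v, rfl⟩ := (t2 w).1 hz
    have : q' ∘ₗ (s.d 2).hom = 0 := by
      ext x
      exact (s.exact 1).apply_apply_eq_zero x
    change (q'.lTensor N) (((s.d 2).hom.lTensor N) v) = 0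
    rw [← LinearMap.comp_apply, ← LinearMap.lTensor_comp, this]
    simp
  refine ⟨inj, ?_⟩
  have hsurj : Function.Surjective (g'.lTensor N) := by
    intro z
    have : g1.lTensor N (K.subtype.lTensor N z) = 0 := by
      rw [← LinearMap.comp_apply, ← LinearMap.lTensor_comp, LinearMap.comp_ker_subtype]
      simp
    obtain ⟨y, hy⟩ := (hN _).1 this
    refine ⟨y, inj ?_⟩
    rw [← hy, hgg, LinearMap.lTensor_comp, LinearMap.comp_apply]
  have hs := surj_of_lTensor_surj (R := R) N g' hsurj
  intro x
  constructor
  · intro hx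
    obtain ⟨y, hy⟩ := hs ⟨x, hx⟩
    exact ⟨y, congrArg Subtype.val hy⟩
  · rintro ⟨y, rfl⟩
    exact LinearMap.congr_fun h01 y

/-! ### duals -/

/-- `N ⊗ F^* = Hom(F, N)` -/
def dualEquiv (N F : Type) [AddCommGroup N] [Module R N] [AddCommGroup F] [Module R F]
    [Module.Free R F] [Module.Finite R F] : (N ⊗[R] (F →ₗ[R] R)) ≃ₗ[R] (F →ₗ[R] N) :=
  TensorProduct.comm R N (F →ₗ[R] R) ≪≫ₗ dualTensorHomEquiv R F N

theorem dualEquiv_nat (N : Type) {F F' : Type} [AddCommGroup N] [Module R N] [AddCommGroup F]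
    [Module R F] [Module.Free R F] [Module.Finite R F] [AddCommGroup F']
    [Module R F'] [Module.Free R F'] [Module.Finite R F'] (d : F' →ₗ[R] F) :
    LinearMap.lcomp R N d ∘ₗ (dualEquiv (R := R) N F).toLinearMap =
      (dualEquiv (R := R) N F').toLinearMap ∘ₗ (LinearMap.lcomp R R d).lTensor N := by
  apply TensorProduct.ext'
  intro x φ
  ext y
  simp [dualEquiv]

theorem exact_dual_iff (N : Type) {F F' F'' : Type} [AddCommGroup N] [Module R N] [AddCommGroup F]
    [Module R F] [Module.Free R F] [Module.Finite R F] [AddCommGroup F']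
    [Module R F'] [Module.Free R F'] [Module.Finite R F'] [AddCommGroup F'']
    [Module R F''] [Module.Free R F''] [Module.Finite R F'']
    (d : F' →ₗ[R] F) (d' : F'' →ₗ[R] F') :
    Function.Exact (LinearMap.lcomp R N d) (LinearMap.lcomp R N d') ↔
    Function.Exact ((LinearMap.lcomp R R d).lTensor N) ((LinearMap.lcomp R R d').lTensor N) :=
  Function.Exact.iff_of_ladder_linearEquiv (dualEquiv_nat N d) (dualEquiv_nat N d')

theorem inj_dual_iff (N : Type) {F F' : Type} [AddCommGroup N] [Module R N] [AddCommGroup F]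
    [Module R F] [Module.Free R F] [Module.Finite R F] [AddCommGroup F']
    [Module R F'] [Module.Free R F'] [Module.Finite R F']
    (d : F' →ₗ[R] F) :
    Function.Injective (LinearMap.lcomp R N d) ↔
    Function.Injective ((LinearMap.lcomp R R d).lTensor N) := by
  have h := congrArg DFunLike.coe (dualEquiv_nat (R := R) N d)
  rw [LinearMap.coe_comp, LinearMap.coe_comp] at h
  rw [← (dualEquiv (R := R) N F').injective.of_comp_iff, 
    ← Function.Injective.of_comp_iff' _ (dualEquiv (R := R) N F).bijective]
  exact iff_of_eq (congrArg _ h)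

theorem back_exact (N : Type) {Y A B C : Type} [AddCommGroup N] [Module R N]
    [AddCommGroup Y] [Module R Y] [AddCommGroup A] [Module R A] [AddCommGroup B] [Module R B]
    [AddCommGroup C] [Module R C] (a : Y →ₗ[R] A) (b : A →ₗ[R] B) (c : B →ₗ[R] C)
    (hab : Function.Exact a b) (hbc : Function.Exact b c)
    (inj : Function.Injective ((LinearMap.ker c).subtype.lTensor N)) :
    Function.Exact (a.lTensor N) (b.lTensor N) := by
  let b' : A →ₗ[R] LinearMap.ker c := b.codRestrict _ hbc.apply_apply_eq_zero
  have hb : b = (LinearMap.ker c).subtype ∘ₗ b' := rfl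
  have hsurj : Function.Surjective b' := by
    rintro ⟨x, hx⟩
    obtain ⟨y, hy⟩ := (hbc x).1 hx
    exact ⟨y, Subtype.ext hy⟩
  have e2 : Function.Exact a b' := by
    intro x
    rw [← hab x, hb, LinearMap.comp_apply]
    simp
  have e3 := lTensor_exact N e2 hsurj
  intro x
  rw [← e3 x, hb, LinearMap.lTensor_comp, LinearMap.comp_apply]
  exact map_eq_zero_iff _ inj

theorem back_inj (N : Type) {A B C : Type} [AddCommGroup N] [Module R N]
    [AddCommGroup A] [Module R A] [AddCommGroup B] [Module R B]
    [AddCommGroup C] [Module R C] (b : A →ₗ[R] B) (c : B →ₗ[R] C)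
    (hb : Function.Injective b) (hbc : Function.Exact b c)
    (inj : Function.Injective ((LinearMap.ker c).subtype.lTensor N)) :
    Function.Injective (b.lTensor N) := by
  have h := back_exact N (0 : PUnit →ₗ[R] A) b c
    ((LinearMap.exact_zero_iff_injective _ _).2 hb) hbc inj
  rwa [LinearMap.lTensor_zero, LinearMap.exact_zero_iff_injective] at h

theorem step [IsNoetherianRing R] [IsLocalRing R]
    (M N : ModuleCat R) [Module.Finite R M] [Module.Finite R N]
    [Nontrivial N] (hrig : TorRigid R N) (i : ℕ) (hi : Subsingleton (ext R i M N)) :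
    Subsingleton (ext R i M (ModuleCat.of R R)) ∧ ∀ j, i = j + 1 →
      Subsingleton (ext R j M (ModuleCat.of R R)) → Subsingleton (ext R j M N) := by
  obtain ⟨P0, ε, h0, f0, n0⟩ := exists_cover (0 : M ⟶ ModuleCat.of R PUnit)
  obtain ⟨P1, f, h1, f1, n1⟩ := exists_cover ε
  have n0 := n0 inferInstance
  have n1 := n1 n0
  let s : Arr R := ⟨P1, P0, f⟩
  have hε : Function.Surjective ε.hom := fun x => (h0 x).1 rfl
  have c := fun N => ext_crit s.X s.d ε (s.proj f1 f0) s.exact h1 hε N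
  have c0 := fun N => ext_crit0 s.X s.d ε (s.proj f1 f0) s.exact h1 hε N
  have ff := s.free f1 f0
  have fn := s.finite n1 n0
  let D : ∀ k, (s.X k →ₗ[R] R) →ₗ[R] (s.X (k + 1) →ₗ[R] R) :=
    fun k => LinearMap.lcomp R R (s.d k).hom
  have hDD : ∀ k, D (k + 1) ∘ₗ D k = 0 := by
    intro k
    ext φ x
    simp [D, (s.exact k).apply_apply_eq_zero]
  have cN : ∀ k, Subsingleton (ext R (k + 1) M N) ↔
      Function.Exact ((D k).lTensor N) ((D (k + 1)).lTensor N) :=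
    fun k => (c N k).trans (exact_dual_iff N _ _)
  have cN0 : Subsingleton (ext R 0 M N) ↔ Function.Injective ((D 0).lTensor N) :=
    (c0 N).trans (inj_dual_iff N _)
  have cR : ∀ k, Subsingleton (ext R (k + 1) M (ModuleCat.of R R)) ↔
      Function.Exact (D k) (D (k + 1)) := fun k => c _ k
  have cR0 : Subsingleton (ext R 0 M (ModuleCat.of R R)) ↔ Function.Injective (D 0) := c0 _
  rcases i with _ | j
  · refine ⟨?_, by simp⟩
    have hj := cN0.1 hi
    have := (key_lemma N hrig (0 : PUnit →ₗ[R] _) (D 0) (by simp) (by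
      rw [LinearMap.lTensor_zero, LinearMap.exact_zero_iff_injective]; exact hj)).2
    rw [LinearMap.exact_zero_iff_injective] at this
    exact cR0.2 this
  · obtain ⟨inj, ex⟩ := key_lemma N hrig (D j) (D (j + 1)) (hDD j) ((cN j).1 hi)
    refine ⟨(cR j).2 ex, ?_⟩
    rintro _ ⟨rfl⟩ hjR
    rcases j with _ | l
    · rw [cN0]
      exact back_inj N (D 0) (D 1) (cR0.1 hjR) ex inj
    · rw [cN]
      exact back_exact N (D l) (D (l + 1)) (D (l + 2)) ((cR l).1 hjR) ex inj

theorem grade_spec (P : ℕ → Prop) (n : ℕ)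
    (hn : (n : ℕ∞) = sInf {i : ℕ∞ | ∃ j : ℕ, i = j ∧ ¬ P j}) :
    ¬ P n ∧ ∀ j < n, P j := by
  constructor
  · have hne : {i : ℕ∞ | ∃ j : ℕ, i = j ∧ ¬ P j}.Nonempty := by
      by_contra h
      rw [Set.not_nonempty_iff_eq_empty] at h
      rw [h, sInf_empty] at hn
      exact ENat.natCast_ne_top n hn
    have := csInf_mem hne
    rw [← hn] at this
    obtain ⟨j, hj, hp⟩ := this
    rwa [Nat.cast_inj.1 hj]
  · intro j hj
    by_contra h
    have : sInf {i : ℕ∞ | ∃ j : ℕ, i = j ∧ ¬ P j} ≤ (j : ℕ∞) := sInf_le ⟨j, rfl, h⟩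
    rw [← hn, Nat.cast_le] at this
    omega

variable (R)

/-- for `N` Tor-rigid, `grade(M,N) ≤ grade(M)` and `Ext^i(M,N) ≠ 0`
for all `grade(M,N) ≤ i ≤ grade(M)`. -/
theorem stmt4 [IsNoetherianRing R] [IsLocalRing R]
    (M N : ModuleCat R) [Module.Finite R M] [Module.Finite R N]
    (hM : Nontrivial M) (hN : Nontrivial N) (hrig : TorRigid R N)
    (n s : ℕ)
    (hn : (n : ℕ∞) =
      sInf {i : ℕ∞ | ∃ j : ℕ, i = j ∧ ¬ Subsingleton (ext R j M (ModuleCat.of R R))})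
    (hs : (s : ℕ∞) =
      sInf {i : ℕ∞ | ∃ j : ℕ, i = j ∧ ¬ Subsingleton (ext R j M N)}) :
    s ≤ n ∧ ∀ i : ℕ, s ≤ i → i ≤ n → ¬ Subsingleton (ext R i M N) := by
  obtain ⟨hn1, hn2⟩ := grade_spec (fun j => Subsingleton (ext R j M (ModuleCat.of R R))) n hn
  obtain ⟨hs1, hs2⟩ := grade_spec (fun j => Subsingleton (ext R j M N)) s hs
  have down : ∀ i, i ≤ n → Subsingleton (ext R i M N) → ∀ j ≤ i, Subsingleton (ext R j M N) := by
    intro i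
    induction i with
    | zero => intro _ h j hj; obtain rfl : j = 0 := by omega
              exact h
    | succ i ih =>
      intro hi h j hj
      rcases Nat.lt_or_ge i j with hlt | hge
      · obtain rfl : j = i + 1 := by omega
        exact h
      · exact ih (by omega) ((step M N hrig (i + 1) h).2 i rfl (hn2 i (by omega))) j hge
  have hnN : ¬ Subsingleton (ext R n M N) := fun h => hn1 (step M N hrig n h).1
  refine ⟨?_, fun i hsi hin h => hs1 (down i hin h s hsi)⟩
  by_contra hlt
  exact hnN (hs2 n (by omega))
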